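/- arXiv:1002.0747 — 7 statements merged into one kernel-verified Lean document; each statement's English description precedes it below -/
import Mathlib

section
/- In the coefficient process on a finite connected graph G, for every vertex v and every time t ≥ 1: if β_v(t+1) ≠ β_v(t), then the dimension of U_v(t) is strictly greater than the dimension of U_v(t−1). -/
open Finset

/-- The coefficient process on a finite graph `G` (paper: Mossel–Tamuz,
"Efficient Bayesian Learning in Social Networks with Gaussian Estimators").
`β t v` is agent `v`'s coefficient vector at time `t`, encoding its unbiased
linear estimator `∑ w, (β t v) w * S w` of the state of the world; `U t v` is
the linear span of the estimators in agent `v`'s memory at time `t`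
(its own and its neighbors' estimators up to time `t`).
Initially `β 0 v = e_v`, and `β (t+1) v` is the unique minimal-norm vector of
the nonempty closed affine set `{x ∈ U t v : ∑ w, x w = 1}`; since that
minimizer exists and is unique, these fields determine the process uniquely. -/
structure CoeffProcess {V : Type*} [Fintype V] [DecidableEq V] (G : SimpleGraph V) where
  /-- agent `v`'s coefficient vector at time `t` -/
  β : ℕ → V → EuclideanSpace ℝ V
  /-- the span of the coefficient vectors observed by `v` up to time `t` -/
  U : ℕ → V → Submodule ℝ (EuclideanSpace ℝ V)
  init : ∀ v : V, β 0 v = EuclideanSpace.single v 1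
  span_eq : ∀ (t : ℕ) (v : V), U t v = Submodule.span ℝ
    {x : EuclideanSpace ℝ V | ∃ s ≤ t, ∃ u : V, (u = v ∨ G.Adj u v) ∧ x = β s u}
  mem_next : ∀ (t : ℕ) (v : V), β (t + 1) v ∈ U t v
  sum_next : ∀ (t : ℕ) (v : V), ∑ w, β (t + 1) v w = 1
  min_next : ∀ (t : ℕ) (v : V), ∀ x ∈ U t v, (∑ w, x w = 1) → ‖β (t + 1) v‖ ≤ ‖x‖

/-- In the coefficient process on a finite connected graph `G`, for every
vertex `v` and every time `t ≥ 1`: if `β_v(t+1) ≠ β_v(t)`, then the dimension of `U_v(t)`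
is strictly greater than the dimension of `U_v(t−1)`. -/
theorem coeff_process_change_increases_dim {V : Type*} [Fintype V] [DecidableEq V]
    (G : SimpleGraph V) (hconn : G.Connected) (P : CoeffProcess G)
    (v : V) (t : ℕ) (ht : 1 ≤ t) (hchange : P.β (t + 1) v ≠ P.β t v) :
    Module.finrank ℝ (P.U (t - 1) v) < Module.finrank ℝ (P.U t v) := by
  obtain ⟨k, rfl⟩ : ∃ k, t = k + 1 := ⟨t - 1, by omega⟩
  rw [show k + 1 - 1 = k from rfl]
  have hle : P.U k v ≤ P.U (k + 1) v := by
    rw [P.span_eq, P.span_eq]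
    apply Submodule.span_mono
    rintro x ⟨s, hs, u, hu, rfl⟩
    exact ⟨s, by omega, u, hu, rfl⟩
  apply Submodule.finrank_lt_finrank_of_lt
  refine lt_of_le_of_ne hle ?_
  intro heq
  apply hchange
  have ha := P.mem_next (k + 1) v
  have hb := P.mem_next k v
  have sa := P.sum_next (k + 1) v
  have sb := P.sum_next k v
  have ma := P.min_next (k + 1) v
  have mb := P.min_next k v
  rw [heq] at hb mb
  generalize P.β (k + 1 + 1) v = a at *
  generalize P.β (k + 1) v = b at *
  have h1 := ma b hb sb
  have h2 := mb a ha sa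
  have hn : ‖a‖ = ‖b‖ := le_antisymm h1 h2
  have h3 := ma ((1 / 2 : ℝ) • (a + b))
    (Submodule.smul_mem _ _ (Submodule.add_mem _ ha hb)) (by
      simp only [PiLp.smul_apply, PiLp.add_apply, smul_eq_mul]
      rw [← Finset.mul_sum, Finset.sum_add_distrib, sa, sb]
      norm_num)
  rw [norm_smul] at h3
  norm_num at h3
  have h4 := parallelogram_law_with_norm ℝ a b
  have h5 : ‖a - b‖ = 0 := by
    rw [← hn] at h4
    nlinarith [norm_nonneg a, norm_nonneg (a - b), norm_nonneg (a + b)]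
  exact sub_eq_zero.mp (norm_eq_zero.mp h5)
end

section
/- In the coefficient process on a finite connected graph G, let u and v be adjacent vertices and let t ≥ 1. If β_u(t) ≠ β_v(t) and ‖β_v(t)‖ ≤ ‖β_u(t)‖, then β_v(t) ∉ U_u(t−1); consequently the dimension of U_u(t) is strictly greater than the dimension of U_u(t−1). -/
open Finset

/-- In the coefficient process on a finite connected graph `G`, let `u` and
`v` be adjacent vertices and let `t ≥ 1`. If `β_u(t) ≠ β_v(t)` and `‖β_v(t)‖ ≤ ‖β_u(t)‖`,
then `β_v(t) ∉ U_u(t−1)`; consequently the dimension of `U_u(t)` is strictly greater than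
the dimension of `U_u(t−1)`. -/
theorem coeff_process_neighbor_learns {V : Type*} [Fintype V] [DecidableEq V]
    (G : SimpleGraph V) (hconn : G.Connected) (P : CoeffProcess G)
    (u v : V) (hadj : G.Adj u v) (t : ℕ) (ht : 1 ≤ t)
    (hne : P.β t u ≠ P.β t v) (hle : ‖P.β t v‖ ≤ ‖P.β t u‖) :
    P.β t v ∉ P.U (t - 1) u ∧
      Module.finrank ℝ (P.U (t - 1) u) < Module.finrank ℝ (P.U t u) := by
  obtain ⟨k, rfl⟩ : ∃ k, t = k + 1 := ⟨t - 1, by omega⟩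
  simp only [Nat.add_sub_cancel]
  have hnot : P.β (k + 1) v ∉ P.U k u := by
    intro hmem
    apply hne
    have hm := P.min_next k u ((1 / 2 : ℝ) • (P.β (k + 1) u + P.β (k + 1) v))
      (Submodule.smul_mem _ _ (Submodule.add_mem _ (P.mem_next k u) hmem))
      (by
        simp only [PiLp.smul_apply, PiLp.add_apply, smul_eq_mul]
        rw [← Finset.mul_sum, Finset.sum_add_distrib, P.sum_next, P.sum_next]
        norm_num)
    rw [norm_smul] at hm
    have h2 : ‖(1 / 2 : ℝ)‖ = 1 / 2 := by norm_num
    rw [h2] at hm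
    have hp := parallelogram_law_with_norm ℝ (P.β (k + 1) u) (P.β (k + 1) v)
    have h0 := norm_nonneg (P.β (k + 1) u)
    have h1 := norm_nonneg (P.β (k + 1) v)
    have h3 : ‖P.β (k + 1) u - P.β (k + 1) v‖ * ‖P.β (k + 1) u - P.β (k + 1) v‖ ≤ 0 := by
      nlinarith [mul_self_le_mul_self h1 hle, mul_self_le_mul_self h0 hm]
    have h4 : ‖P.β (k + 1) u - P.β (k + 1) v‖ = 0 :=
      mul_self_eq_zero.mp (le_antisymm h3 (mul_self_nonneg _))
    exact sub_eq_zero.mp (norm_eq_zero.mp h4)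
  refine ⟨hnot, Submodule.finrank_lt_finrank_of_lt (lt_of_le_of_ne ?_ ?_)⟩
  · rw [P.span_eq, P.span_eq]
    apply Submodule.span_mono
    rintro x ⟨s, hs, w, hw, rfl⟩
    exact ⟨s, by omega, w, hw, rfl⟩
  · intro (h : P.U k u = P.U (k + 1) u)
    apply hnot
    rw [h, P.span_eq]
    exact Submodule.subset_span ⟨k + 1, le_rfl, v, Or.inr hadj.symm, rfl⟩
end

section
/- In the coefficient process on a finite connected graph G with n vertices, for every time t ≥ n² and all vertices u, v ∈ V: β_u(t) = β_v(t). That is, the process converges, with all agents holding the same estimator, after at most n² iterations. -/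
open Finset

/-- uniqueness of the norm minimizer -/
theorem cp_uniq {V : Type*} [Fintype V] (A : Submodule ℝ (EuclideanSpace ℝ V))
    (x y : EuclideanSpace ℝ V) (hx : x ∈ A) (hy : y ∈ A) (sx : ∑ w, x w = 1) (sy : ∑ w, y w = 1)
    (mx : ∀ z ∈ A, (∑ w, z w = 1) → ‖x‖ ≤ ‖z‖) (hxy : ‖y‖ ≤ ‖x‖) : x = y := by
  have e : ‖x‖ = ‖y‖ := le_antisymm (mx y hy sy) hxy
  have hm := mx ((1/2 : ℝ) • (x + y)) (A.smul_mem _ (A.add_mem hx hy)) (by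
    simp only [PiLp.smul_apply, PiLp.add_apply, smul_eq_mul, ← Finset.mul_sum,
      Finset.sum_add_distrib, sx, sy]
    norm_num)
  rw [norm_smul] at hm
  have p := parallelogram_law_with_norm ℝ x y
  norm_num at hm
  have hz : ‖x - y‖ = 0 := by
    have h0 := norm_nonneg x
    have : ‖x - y‖ * ‖x - y‖ ≤ 0 := by
      rw [← e] at p
      nlinarith
    exact mul_self_eq_zero.mp (le_antisymm this (mul_self_nonneg _))
  exact sub_eq_zero.mp (norm_eq_zero.mp hz)

section
variable {V : Type*} [Fintype V] [DecidableEq V] {G : SimpleGraph V} (P : CoeffProcess G)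

theorem cp_mem {s t : ℕ} (h : s ≤ t) {u v : V} (huv : u = v ∨ G.Adj u v) : P.β s u ∈ P.U t v := by
  rw [P.span_eq]
  exact Submodule.subset_span ⟨s, h, u, huv, rfl⟩

theorem cp_mono {s t : ℕ} (h : s ≤ t) (v : V) : P.U s v ≤ P.U t v := by
  rw [P.span_eq s v, Submodule.span_le]
  rintro x ⟨r, hr, u, hu, rfl⟩
  exact cp_mem P (hr.trans h) hu

theorem cp_stat {r : ℕ} (h : P.U r = P.U (r + 1)) : P.U (r + 1) = P.U (r + 2) := by
  have hb : ∀ v, P.β (r + 1) v = P.β (r + 2) v := by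
    intro v
    have m2 : P.β (r + 2) v ∈ P.U r v := by rw [h]; exact P.mem_next (r + 1) v
    refine cp_uniq (P.U r v) _ _ (P.mem_next r v) m2 (P.sum_next r v) (P.sum_next (r + 1) v)
      (P.min_next r v) ?_
    refine P.min_next (r + 1) v _ ?_ (P.sum_next r v)
    exact cp_mem P le_rfl (Or.inl rfl)
  funext v
  refine le_antisymm (cp_mono P (by omega) v) ?_
  rw [P.span_eq (r + 2) v, Submodule.span_le]
  rintro x ⟨s, hs, u, hu, rfl⟩
  rcases Nat.lt_or_ge s (r + 2) with h1 | h1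
  · exact cp_mem P (by omega) hu
  · obtain rfl : s = r + 2 := le_antisymm hs h1
    rw [← hb u]
    exact cp_mem P le_rfl hu

theorem cp_exists [Nonempty V] : ∃ s < (Fintype.card V) ^ 2, P.U s = P.U (s + 1) := by
  by_contra! hne
  have key : ∀ s ≤ (Fintype.card V) ^ 2, s + 1 ≤ ∑ v, Module.finrank ℝ (P.U s v) := by
    intro s
    induction s with
    | zero =>
      intro _
      obtain ⟨v⟩ := ‹Nonempty V›
      have h1 : 1 ≤ Module.finrank ℝ (P.U 0 v) := by
        rw [Submodule.one_le_finrank_iff]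
        intro hb
        have hm : P.β 0 v ∈ P.U 0 v := cp_mem P le_rfl (Or.inl rfl)
        rw [hb, Submodule.mem_bot, P.init] at hm
        simp at hm
      exact h1.trans (Finset.single_le_sum (f := fun v => Module.finrank ℝ (P.U 0 v))
        (fun _ _ => Nat.zero_le _) (Finset.mem_univ v))
    | succ s ih =>
      intro hs
      have h1 := ih (by omega)
      obtain ⟨v, hv⟩ := Function.ne_iff.mp (hne s (by omega))
      have : ∑ v, Module.finrank ℝ (P.U s v) < ∑ v, Module.finrank ℝ (P.U (s + 1) v) := by
        refine Finset.sum_lt_sum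
          (fun w _ => Submodule.finrank_mono (cp_mono P (Nat.le_succ s) w)) ⟨v, Finset.mem_univ v, ?_⟩
        exact Submodule.finrank_lt_finrank_of_lt (lt_of_le_of_ne (cp_mono P (Nat.le_succ s) v) hv)
      omega
  have h1 := key _ le_rfl
  have h2 : ∑ v, Module.finrank ℝ (P.U ((Fintype.card V) ^ 2) v) ≤ ∑ _v : V, Fintype.card V := by
    refine Finset.sum_le_sum fun v _ => ?_
    refine (Submodule.finrank_le _).trans ?_
    simp
  simp only [Finset.sum_const, Finset.card_univ, smul_eq_mul] at h2
  rw [← sq] at h2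
  omega

end

/-- In the coefficient process on a finite connected graph `G` with `n`
vertices, for every time `t ≥ n²` and all vertices `u, v`: `β_u(t) = β_v(t)`. That is,
the process converges, with all agents holding the same estimator, after at most `n²`
iterations. -/
theorem coeff_process_converges_nsq {V : Type*} [Fintype V] [DecidableEq V]
    (G : SimpleGraph V) (hconn : G.Connected) (P : CoeffProcess G)
    (t : ℕ) (ht : (Fintype.card V) ^ 2 ≤ t) (u v : V) :
    P.β t u = P.β t v := by
  haveI := hconn.nonempty
  obtain ⟨s, hs, he⟩ := cp_exists P
  have hst : ∀ k, P.U (s + k) = P.U (s + k + 1) := by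
    intro k
    induction k with
    | zero => exact he
    | succ k ih => exact cp_stat P ih
  obtain ⟨k, rfl⟩ : ∃ k, t = s + k + 1 := ⟨t - s - 1, by omega⟩
  have hadj : ∀ a b, G.Adj a b → P.β (s + k + 1) a = P.β (s + k + 1) b := by
    have hm : ∀ a b, G.Adj a b → P.β (s + k + 1) a ∈ P.U (s + k) b := by
      intro a b hab
      rw [hst k]
      exact cp_mem P le_rfl (Or.inr hab)
    intro a b hab
    exact cp_uniq (P.U (s + k) a) _ _ (P.mem_next _ a) (hm b a hab.symm) (P.sum_next _ a)
      (P.sum_next _ b) (P.min_next _ a) (P.min_next _ b _ (hm a b hab) (P.sum_next _ a))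
  obtain ⟨w⟩ := hconn.preconnected u v
  induction w with
  | nil => rfl
  | cons h _ ih => exact (hadj _ _ h).trans ih
end

section
/- In the coefficient process on a finite connected graph G of diameter d, suppose that for some vertex u and some time t₀ the estimator of u is unchanged for 2d steps: β_u(t₀ + s) = β_u(t₀) for all 0 ≤ s ≤ 2d. Then for every 0 ≤ i ≤ d, every vertex w at graph distance i from u, and every time t with t₀ + i ≤ t ≤ t₀ + 2d − i, one has β_w(t) = β_u(t₀). -/
open Finset

theorem CoeffProcess.sum_eq_one {V : Type*} [Fintype V] [DecidableEq V] {G : SimpleGraph V}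
    (P : CoeffProcess G) (t : ℕ) (v : V) : ∑ w, P.β t v w = 1 := by
  cases t with
  | zero => rw [P.init]; simp
  | succ t => exact P.sum_next t v

theorem CoeffProcess.mem_U {V : Type*} [Fintype V] [DecidableEq V] {G : SimpleGraph V}
    (P : CoeffProcess G) {s t : ℕ} {u v : V} (hs : s ≤ t) (h : G.Adj u v) :
    P.β s u ∈ P.U t v := by
  rw [P.span_eq]
  exact Submodule.subset_span ⟨s, hs, u, Or.inr h, rfl⟩

theorem CoeffProcess.unique {V : Type*} [Fintype V] [DecidableEq V] {G : SimpleGraph V}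
    (P : CoeffProcess G) (t : ℕ) (v : V) (b : EuclideanSpace ℝ V) (hb : b ∈ P.U t v)
    (hb1 : ∑ w, b w = 1) (hn : ‖b‖ ≤ ‖P.β (t + 1) v‖) : P.β (t + 1) v = b := by
  have hm := P.min_next t v ((1 / 2 : ℝ) • (P.β (t + 1) v + b))
    (Submodule.smul_mem _ _ (Submodule.add_mem _ (P.mem_next t v) hb)) (by
      simp only [PiLp.smul_apply, PiLp.add_apply, smul_eq_mul]
      rw [← Finset.mul_sum, Finset.sum_add_distrib, hb1, P.sum_next]
      norm_num)
  rw [norm_smul] at hm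
  norm_num at hm
  have hp := parallelogram_law_with_norm ℝ (P.β (t + 1) v) b
  have h0 := norm_nonneg b
  have h1 := norm_nonneg (P.β (t + 1) v)
  have h2 : ‖P.β (t + 1) v - b‖ * ‖P.β (t + 1) v - b‖ ≤ 0 := by nlinarith
  have h3 : ‖P.β (t + 1) v - b‖ = 0 := by
    have := norm_nonneg (P.β (t + 1) v - b)
    nlinarith
  exact sub_eq_zero.mp (norm_eq_zero.mp h3)

theorem CoeffProcess.walk_aux {V : Type*} [Fintype V] [DecidableEq V] {G : SimpleGraph V}
    (P : CoeffProcess G) (d t₀ : ℕ) (b : EuclideanSpace ℝ V) (w u : V) (p : G.Walk w u)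
    (hstag : ∀ s ≤ 2 * d, P.β (t₀ + s) u = b) :
    ∀ t, t₀ + p.length ≤ t → t + p.length ≤ t₀ + 2 * d → P.β t w = b := by
  induction p with
  | nil =>
    intro t h1 h2
    simp only [SimpleGraph.Walk.length_nil] at h1 h2
    have := hstag (t - t₀) (by omega)
    rwa [show t₀ + (t - t₀) = t by omega] at this
  | @cons w x u h p ih =>
    intro t h1 h2
    simp only [SimpleGraph.Walk.length_cons] at h1 h2
    obtain ⟨r, rfl⟩ : ∃ r, t = r + 1 := ⟨t - 1, by omega⟩
    have hr := ih hstag r (by omega) (by omega)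
    have hr2 := ih hstag (r + 1 + 1) (by omega) (by omega)
    apply P.unique
    · rw [← hr]; exact P.mem_U le_rfl h.symm
    · rw [← hr]; exact P.sum_eq_one r x
    · rw [← hr2]
      exact P.min_next (r + 1) x _ (P.mem_U le_rfl h) (P.sum_eq_one _ _)

/-- In the coefficient process on a finite connected graph `G` of diameter
`d`, suppose that for some vertex `u` and some time `t₀` the estimator of `u` is unchanged
for `2d` steps: `β_u(t₀ + s) = β_u(t₀)` for all `0 ≤ s ≤ 2d`. Then for every `0 ≤ i ≤ d`,
every vertex `w` at graph distance `i` from `u`, and every time `t` with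
`t₀ + i ≤ t ≤ t₀ + 2d − i`, one has `β_w(t) = β_u(t₀)`. -/
theorem coeff_process_stagnation_propagates {V : Type*} [Fintype V] [DecidableEq V]
    (G : SimpleGraph V) (hconn : G.Connected) (P : CoeffProcess G)
    (d : ℕ) (hd : G.diam = d) (u : V) (t₀ : ℕ)
    (hstag : ∀ s ≤ 2 * d, P.β (t₀ + s) u = P.β t₀ u)
    (i : ℕ) (hi : i ≤ d) (w : V) (hw : G.dist u w = i)
    (t : ℕ) (ht₁ : t₀ + i ≤ t) (ht₂ : t ≤ t₀ + 2 * d - i) :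
    P.β t w = P.β t₀ u := by
  obtain ⟨p, hp⟩ := hconn.exists_walk_length_eq_dist w u
  rw [SimpleGraph.dist_comm, hw] at hp
  exact P.walk_aux d t₀ _ w u p hstag t (by omega) (by omega)
end

section
/- In the coefficient process on a finite connected graph G of diameter d, suppose that for some vertex u and some time t₀ the estimator of u is unchanged for 2d steps: β_u(t₀ + s) = β_u(t₀) for all 0 ≤ s ≤ 2d. Then the process has converged: for every vertex w and every time t ≥ t₀ + d, β_w(t) = β_u(t₀). -/
open Finset

namespace CoeffProcess

theorem sum_all {V : Type*} [Fintype V] [DecidableEq V] {G : SimpleGraph V}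
    (P : CoeffProcess G) (t : ℕ) (v : V) : ∑ w, P.β t v w = 1 := by
  cases t with
  | zero => rw [P.init]; simp
  | succ t => exact P.sum_next t v

theorem mem_U_s13 {V : Type*} [Fintype V] [DecidableEq V] {G : SimpleGraph V}
    (P : CoeffProcess G) {s t : ℕ} (hst : s ≤ t) {v w : V} (h : w = v ∨ G.Adj w v) :
    P.β s w ∈ P.U t v := by
  rw [P.span_eq]
  exact Submodule.subset_span ⟨s, hst, w, h, rfl⟩

theorem uniq {V : Type*} [Fintype V] [DecidableEq V] {G : SimpleGraph V}
    (P : CoeffProcess G) (t : ℕ) (v : V) (x : EuclideanSpace ℝ V) (hx : x ∈ P.U t v)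
    (hs : ∑ w, x w = 1) (hn : ‖x‖ ≤ ‖P.β (t + 1) v‖) : x = P.β (t + 1) v := by
  set y := P.β (t + 1) v with hy
  have hm : (1 / 2 : ℝ) • (x + y) ∈ P.U t v :=
    Submodule.smul_mem _ _ (Submodule.add_mem _ hx (P.mem_next t v))
  have hsum : ∑ w, ((1 / 2 : ℝ) • (x + y)) w = 1 := by
    have h2 := P.sum_next t v
    rw [← hy] at h2
    simp only [PiLp.smul_apply, PiLp.add_apply, smul_eq_mul]
    rw [← Finset.mul_sum, Finset.sum_add_distrib, hs, h2]
    norm_num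
  have hmin := P.min_next t v _ hm hsum
  rw [← hy, norm_smul] at hmin
  norm_num at hmin
  have hp := parallelogram_law_with_norm ℝ x y
  have h0 : ‖x - y‖ = 0 := by
    have := norm_nonneg x
    have := norm_nonneg y
    have := norm_nonneg (x - y)
    have h3 : ‖x - y‖ * ‖x - y‖ ≤ 0 := by nlinarith
    nlinarith
  exact sub_eq_zero.mp (norm_eq_zero.mp h0)

theorem spread {V : Type*} [Fintype V] [DecidableEq V] {G : SimpleGraph V}
    (P : CoeffProcess G) (d t₀ : ℕ) (b : EuclideanSpace ℝ V) {w u : V} (p : G.Walk w u)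
    (hstag : ∀ s ≤ 2 * d, P.β (t₀ + s) u = b) :
    ∀ t, t₀ + p.length ≤ t → t + p.length ≤ t₀ + 2 * d → P.β t w = b := by
  induction p with
  | nil =>
    intro t h1 h2
    simp only [SimpleGraph.Walk.length_nil] at h1 h2
    obtain ⟨s, rfl⟩ := Nat.exists_eq_add_of_le h1
    exact hstag s (by omega)
  | @cons w w' u h p ih =>
    intro t h1 h2
    rw [SimpleGraph.Walk.length_cons] at h1 h2
    obtain ⟨t, rfl⟩ : ∃ t', t = t' + 1 := ⟨t - 1, by omega⟩
    have e1 := ih hstag t (by omega) (by omega)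
    have e2 := ih hstag (t + 1 + 1) (by omega) (by omega)
    rw [← e2]
    refine P.uniq (t + 1) w' _ (P.mem_U_s13 le_rfl (Or.inr h)) (P.sum_all _ _) ?_
    rw [e2, ← e1]
    exact P.min_next t w _ (P.mem_U_s13 le_rfl (Or.inr h.symm)) (P.sum_all _ _)

theorem step {V : Type*} [Fintype V] [DecidableEq V] {G : SimpleGraph V}
    (P : CoeffProcess G) (T : ℕ) (b : EuclideanSpace ℝ V) (hT : ∀ w, P.β T w = b) (w : V) :
    P.β (T + 1) w = b := by
  have hmem := P.mem_next T w
  cases T with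
  | zero =>
    have hle : P.U 0 w ≤ Submodule.span ℝ {b} := by
      rw [P.span_eq, Submodule.span_le]
      rintro x ⟨s, hs, v, -, rfl⟩
      obtain rfl : s = 0 := by omega
      rw [hT v]
      exact Submodule.mem_span_singleton_self b
    obtain ⟨c, hc⟩ := Submodule.mem_span_singleton.mp (hle hmem)
    have h1 := P.sum_all (0 + 1) w
    have h2 := P.sum_all 0 w
    rw [hT w] at h2
    rw [← hc] at h1 ⊢
    simp only [PiLp.smul_apply, smul_eq_mul] at h1
    rw [← Finset.mul_sum, h2, mul_one] at h1
    rw [h1, one_smul]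
  | succ T =>
    have hle : P.U (T + 1) w ≤ P.U T w := by
      rw [P.span_eq (T + 1), Submodule.span_le]
      rintro x ⟨s, hs, v, hv, rfl⟩
      rcases Nat.lt_or_ge T s with h | h
      · obtain rfl : s = T + 1 := by omega
        rw [hT v, ← hT w]
        exact P.mem_next T w
      · exact P.mem_U_s13 h hv
    rw [← hT w]
    exact P.uniq T w _ (hle hmem) (P.sum_all _ _)
      (P.min_next (T + 1) w _ (P.mem_U_s13 le_rfl (Or.inl rfl)) (P.sum_all _ _))

end CoeffProcess

/-- In the coefficient process on a finite connected graph `G` of diameter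
`d`, suppose that for some vertex `u` and some time `t₀` the estimator of `u` is unchanged
for `2d` steps: `β_u(t₀ + s) = β_u(t₀)` for all `0 ≤ s ≤ 2d`. Then the process has
converged: for every vertex `w` and every time `t ≥ t₀ + d`, `β_w(t) = β_u(t₀)`. -/
theorem coeff_process_stagnation_lemma {V : Type*} [Fintype V] [DecidableEq V]
    (G : SimpleGraph V) (hconn : G.Connected) (P : CoeffProcess G)
    (d : ℕ) (hd : G.diam = d) (u : V) (t₀ : ℕ)
    (hstag : ∀ s ≤ 2 * d, P.β (t₀ + s) u = P.β t₀ u) :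
    ∀ w : V, ∀ t : ℕ, t₀ + d ≤ t → P.β t w = P.β t₀ u := by
  intro w t ht
  have base : ∀ w, P.β (t₀ + d) w = P.β t₀ u := by
    intro w
    obtain ⟨p, hp⟩ := hconn.exists_walk_length_eq_dist w u
    haveI := hconn.nonempty
    have hle : G.dist w u ≤ d := by
      rw [← hd]
      exact SimpleGraph.dist_le_diam (SimpleGraph.connected_iff_ediam_ne_top.mp hconn)
    exact P.spread d t₀ _ p hstag _ (by omega) (by omega)
  have key : ∀ k, ∀ w, P.β (t₀ + d + k) w = P.β t₀ u := by
    intro k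
    induction k with
    | zero => exact base
    | succ k ih => exact fun w => P.step _ _ ih w
  obtain ⟨k, rfl⟩ := Nat.exists_eq_add_of_le ht
  exact key k w
end

section
/- In the coefficient process on a finite connected graph G with n vertices, for every vertex v and every time t ≥ 0, the v-th coordinate of agent v's own coefficient vector satisfies (β_v(t))_v ≥ 1/n. -/
open Finset

/-- In the coefficient process on a finite connected graph `G` with `n`
vertices, for every vertex `v` and every time `t ≥ 0`, the `v`-th coordinate of agent
`v`'s own coefficient vector satisfies `(β_v(t))_v ≥ 1/n`. -/
theorem coeff_process_self_weight {V : Type*} [Fintype V] [DecidableEq V]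
    (G : SimpleGraph V) (hconn : G.Connected) (P : CoeffProcess G)
    (v : V) (t : ℕ) :
    (1 : ℝ) / (Fintype.card V) ≤ P.β t v v := by
  have hn : (0 : ℝ) < Fintype.card V := by
    have : Nonempty V := ⟨v⟩
    exact_mod_cast Fintype.card_pos
  cases t with
  | zero =>
    rw [P.init]
    simp only [PiLp.single_apply, if_true]
    rw [div_le_one hn]
    have : Nonempty V := ⟨v⟩
    exact_mod_cast Fintype.card_pos (α := V)
  | succ t =>
    have hmem : EuclideanSpace.single v (1 : ℝ) ∈ P.U t v := by
      rw [P.span_eq]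
      exact Submodule.subset_span ⟨0, Nat.zero_le _, v, Or.inl rfl, (P.init v).symm⟩
    have hb := P.mem_next t v
    have hs := P.sum_next t v
    have hmin := P.min_next t v
    generalize P.β (t + 1) v = b at hb hs hmin ⊢
    set d : EuclideanSpace ℝ V := EuclideanSpace.single v (1 : ℝ) - b with hd
    have hds : ∑ w, d w = 0 := by
      simp [hd, hs, Finset.sum_sub_distrib]
    have hq : ∀ s : ℝ, 0 ≤ ‖d‖ ^ 2 * (s * s) + (2 * inner ℝ b d) * s + 0 := by
      intro s
      have h1 := hmin (b + s • d)
        ((P.U t v).add_mem hb ((P.U t v).smul_mem s ((P.U t v).sub_mem hmem hb)))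
        (by simp [Finset.sum_add_distrib, ← Finset.mul_sum, hs, hds])
      have h2 := pow_le_pow_left₀ (norm_nonneg _) h1 2
      rw [norm_add_sq_real, inner_smul_right, norm_smul, mul_pow, Real.norm_eq_abs, sq_abs] at h2
      nlinarith
    have hdis := discrim_le_zero hq
    unfold discrim at hdis
    have hc : inner ℝ b d = 0 := by
      have : (inner ℝ b d : ℝ) ^ 2 ≤ 0 := by nlinarith
      exact pow_eq_zero_iff (two_ne_zero) |>.1 (le_antisymm this (sq_nonneg _))
    have hv : b v = ‖b‖ ^ 2 := by
      rw [hd, inner_sub_right, real_inner_self_eq_norm_sq, EuclideanSpace.inner_single_right] at hc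
      simp at hc
      linarith
    rw [hv, EuclideanSpace.real_norm_sq_eq, div_le_iff₀ hn]
    have := sq_sum_le_card_mul_sum_sq (s := (Finset.univ : Finset V)) (f := fun w => b w)
    rw [hs] at this
    simp only [Finset.card_univ] at this
    linarith
end

section
/- In the coefficient process on a finite connected graph G, suppose that at some time t ≥ 1 all agents hold the same coefficient vector: there is x ∈ ℝ^V with β_v(t) = x for every vertex v. Then β_v(s) = x for every vertex v and every time s ≥ t. -/
open Finset

/-- In the coefficient process on a finite connected graph `G`, suppose that
at some time `t ≥ 1` all agents hold the same coefficient vector `x`. Then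
`β_v(s) = x` for every vertex `v` and every time `s ≥ t`: agreement is absorbing. -/
theorem coeff_process_agreement_absorbing {V : Type*} [Fintype V] [DecidableEq V]
    (G : SimpleGraph V) (hconn : G.Connected) (P : CoeffProcess G)
    (t : ℕ) (ht : 1 ≤ t) (x : EuclideanSpace ℝ V) (hx : ∀ v : V, P.β t v = x) :
    ∀ s : ℕ, t ≤ s → ∀ v : V, P.β s v = x := by
  obtain ⟨r, rfl⟩ : ∃ r, t = r + 1 := ⟨t - 1, by omega⟩
  have hmem : ∀ v, x ∈ P.U r v := fun v => by
    have h := P.mem_next r v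
    rwa [hx v] at h
  have hmin : ∀ v, ∀ y ∈ P.U r v, (∑ w, y w = 1) → ‖x‖ ≤ ‖y‖ := fun v => by
    have h := P.min_next r v
    rwa [hx v] at h
  intro s
  induction s using Nat.strong_induction_on with
  | _ s ih =>
    intro hs v
    rcases Nat.eq_or_lt_of_le hs with h | h
    · rw [← h]; exact hx v
    obtain ⟨m, rfl⟩ : ∃ m, s = m + 1 := ⟨s - 1, by omega⟩
    have hU : P.U m v ≤ P.U r v := by
      rw [P.span_eq m v, Submodule.span_le]
      rintro y ⟨k, hk, u, hu, rfl⟩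
      by_cases hkr : k ≤ r
      · rw [P.span_eq r v]
        exact Submodule.subset_span ⟨k, hkr, u, hu, rfl⟩
      · rw [ih k (by omega) (by omega) u]
        exact hmem v
    have hxm : x ∈ P.U m v := by
      rw [P.span_eq m v]
      exact Submodule.subset_span ⟨r + 1, by omega, v, Or.inl rfl, (hx v).symm⟩
    have hxs : ∑ w, x w = 1 := by
      have h := P.sum_next r v
      rwa [hx v] at h
    have hys := P.sum_next m v
    have hym := hU (P.mem_next m v)
    have h1 := P.min_next m v x hxm hxs
    generalize P.β (m + 1) v = y at *
    have h2 := hmin v ((1 / 2 : ℝ) • (x + y))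
      (Submodule.smul_mem _ _ (Submodule.add_mem _ (hmem v) hym)) (by
        simp only [PiLp.smul_apply, PiLp.add_apply, smul_eq_mul]
        rw [← Finset.mul_sum, Finset.sum_add_distrib, hxs, hys]; norm_num)
    rw [norm_smul] at h2
    norm_num at h2
    have h3 := parallelogram_law_with_norm ℝ x y
    have h4 : ‖x - y‖ * ‖x - y‖ ≤ 0 := by
      nlinarith [norm_nonneg x, norm_nonneg y, norm_nonneg (x + y)]
    have h5 : ‖x - y‖ = 0 := by nlinarith [norm_nonneg (x - y)]
    exact (sub_eq_zero.1 (norm_eq_zero.1 h5)).symm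
end
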